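/- For every $\alpha\in(-\log s_1,-\log s_2)$, the Hausdorff dimension, computed in the ultrametric space $(\partial\mathscr{A}_{1,2}^\ast,d)$, of the level set $X_\mu(\alpha)$ equals $\min\{\theta_a^\ast(\alpha),\theta_b^\ast(\alpha)\}$. -/

import Mathlib

open MeasureTheory Metric Set Filter Topology Classical
open scoped ENNReal NNReal

noncomputable section

namespace MF

/-! ### Olsen's multifractal measures and dimension functions on a metric space -/

variable {X : Type} [MetricSpace X]

/-- The sum `∑ m(B(xᵢ,rᵢ))^q (2rᵢ)^t` associated with a countable family of centered balls. -/
def olsenSum [MeasurableSpace X] (m : Measure X) (q t : ℝ) {ι : Type}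
    (c : ι → X) (r : ι → ℝ) : ℝ≥0∞ :=
  ∑' i, m (closedBall (c i) (r i)) ^ q * ENNReal.ofReal (2 * r i) ^ t

/-- `Olsen's 𝓗^{q,t}_{m,δ}`: infimum over countable centered `δ`-coverings of `E`. -/
def Hdel [MeasurableSpace X] (m : Measure X) (q t δ : ℝ) (E : Set X) : ℝ≥0∞ :=
  ⨅ (ι : Type) (_ : Countable ι) (c : ι → X) (r : ι → ℝ)
    (_ : ∀ i, c i ∈ E) (_ : ∀ i, 0 < r i ∧ r i ≤ δ)
    (_ : E ⊆ ⋃ i, closedBall (c i) (r i)), olsenSum m q t c r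

/-- Olsen's premeasure `𝓗̄^{q,t}_m` (limit, i.e. supremum, as `δ ↓ 0`). -/
def Hpre [MeasurableSpace X] (m : Measure X) (q t : ℝ) (E : Set X) : ℝ≥0∞ :=
  ⨆ (δ : ℝ) (_ : 0 < δ), Hdel m q t δ E

/-- Olsen's multifractal Hausdorff measure `𝓗^{q,t}_m`. -/
def Hmeas [MeasurableSpace X] (m : Measure X) (q t : ℝ) (E : Set X) : ℝ≥0∞ :=
  ⨆ (F : Set X) (_ : F ⊆ E), Hpre m q t F

/-- `𝓟̄^{q,t}_{m,δ}`: supremum over countable centered `δ`-packings of `E`. -/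
def Pdel [MeasurableSpace X] (m : Measure X) (q t δ : ℝ) (E : Set X) : ℝ≥0∞ :=
  ⨆ (ι : Type) (_ : Countable ι) (c : ι → X) (r : ι → ℝ)
    (_ : ∀ i, c i ∈ E) (_ : ∀ i, 0 < r i ∧ r i ≤ δ)
    (_ : ∀ i j, i ≠ j → Disjoint (closedBall (c i) (r i)) (closedBall (c j) (r j))),
    olsenSum m q t c r

/-- Olsen's packing premeasure `𝓟̄^{q,t}_m` (limit, i.e. infimum, as `δ ↓ 0`). -/
def Ppre [MeasurableSpace X] (m : Measure X) (q t : ℝ) (E : Set X) : ℝ≥0∞ :=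
  ⨅ (δ : ℝ) (_ : 0 < δ), Pdel m q t δ E

/-- Olsen's multifractal packing measure `𝓟^{q,t}_m`. -/
def Pmeas [MeasurableSpace X] (m : Measure X) (q t : ℝ) (E : Set X) : ℝ≥0∞ :=
  ⨅ (En : ℕ → Set X) (_ : E ⊆ ⋃ n, En n), ∑' n, Ppre m q t (En n)

/-- The (topological) support of a measure on a metric space. -/
def msupport [MeasurableSpace X] (m : Measure X) : Set X :=
  {x | ∀ r : ℝ, 0 < r → 0 < m (ball x r)}

/-- Olsen's multifractal Hausdorff dimension function `b_m`. -/
def bFun [MeasurableSpace X] (m : Measure X) (q : ℝ) : ℝ :=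
  sInf {t | Hmeas m q t (msupport m) = 0}

/-- Olsen's multifractal packing dimension function `B_m`. -/
def BFun [MeasurableSpace X] (m : Measure X) (q : ℝ) : ℝ :=
  sInf {t | Pmeas m q t (msupport m) = 0}

/-- Olsen's function `τ_m`. -/
def tauFun [MeasurableSpace X] (m : Measure X) (q : ℝ) : ℝ :=
  sInf {t | Ppre m q t (msupport m) = 0}

/-- `t`-dimensional packing pre-premeasure at scale `δ`. -/
def pPdel (t δ : ℝ) (E : Set X) : ℝ≥0∞ :=
  ⨆ (ι : Type) (_ : Countable ι) (c : ι → X) (r : ι → ℝ)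
    (_ : ∀ i, c i ∈ E) (_ : ∀ i, 0 < r i ∧ r i ≤ δ)
    (_ : ∀ i j, i ≠ j → Disjoint (closedBall (c i) (r i)) (closedBall (c j) (r j))),
    ∑' i, ENNReal.ofReal (2 * r i) ^ t

/-- `t`-dimensional packing premeasure. -/
def pPpre (t : ℝ) (E : Set X) : ℝ≥0∞ := ⨅ (δ : ℝ) (_ : 0 < δ), pPdel t δ E

/-- `t`-dimensional packing measure. -/
def pPmeas (t : ℝ) (E : Set X) : ℝ≥0∞ :=
  ⨅ (En : ℕ → Set X) (_ : E ⊆ ⋃ n, En n), ∑' n, pPpre t (En n)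

/-- Packing dimension of a set. -/
def packDim (E : Set X) : ℝ := sInf {t | pPmeas t E = 0}

/-- The level set `X_m(α)` of points of the support where the local Hölder exponent is `α`. -/
def Xlev [MeasurableSpace X] (m : Measure X) (α : ℝ) : Set X :=
  {x | x ∈ msupport m ∧
    Tendsto (fun r => Real.log (m (closedBall x r)).toReal / Real.log r)
      (𝓝[>] (0 : ℝ)) (𝓝 α)}

/-- Legendre transform `f^*(x) = inf_y (xy + f(y))`. -/
def leg (f : ℝ → ℝ) (x : ℝ) : ℝ := ⨅ y : ℝ, (x * y + f y)

/-! ### The mixed symbolic space and inhomogeneous multinomial measures -/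

/-- `j` is an index governed by the first alphabet:
`T (2k-1) ≤ j < T (2k)` for some `k ≥ 1`. -/
def isA (T : ℕ → ℕ) (j : ℕ) : Prop :=
  ∃ k, 1 ≤ k ∧ T (2 * k - 1) ≤ j ∧ j < T (2 * k)

/-- The size of the alphabet at (0-based) position `n`, i.e. at paper index `j = n+1`. -/
def Yc (c₁ c₂ : ℕ) (T : ℕ → ℕ) (n : ℕ) : ℕ := if isA T (n + 1) then c₁ else c₂

/-- The mixed symbolic space `∂𝒜₁,₂* = ∏ⱼ Yⱼ`. -/
abbrev Omg (c₁ c₂ : ℕ) (T : ℕ → ℕ) : Type := ∀ n : ℕ, Fin (Yc c₁ c₂ T n)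

/-- Finite words of length `n`. -/
abbrev Word (c₁ c₂ : ℕ) (T : ℕ → ℕ) (n : ℕ) : Type :=
  ∀ i : Fin n, Fin (Yc c₁ c₂ T i.val)

/-- `N_n`: the number of indices `1 ≤ j ≤ n` governed by the first alphabet. -/
def Ncount (T : ℕ → ℕ) (n : ℕ) : ℕ := ((Finset.Icc 1 n).filter (isA T)).card

/-- Diameter `c₁^{-N_n} c₂^{-(n-N_n)}` of a cylinder of generation `n`. -/
def Dw (c₁ c₂ : ℕ) (T : ℕ → ℕ) (n : ℕ) : ℝ :=
  ((c₁ : ℝ) ^ Ncount T n * (c₂ : ℝ) ^ (n - Ncount T n))⁻¹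

/-- The cylinder `[w]` defined by a finite word `w`. -/
def cyl (c₁ c₂ : ℕ) (T : ℕ → ℕ) (n : ℕ) (w : Word c₁ c₂ T n) : Set (Omg c₁ c₂ T) :=
  {x | ∀ i : Fin n, x i.val = w i}

/-- The mass `∏_{j≤n} p_j` given to the cylinder `[w]` by the inhomogeneous
multinomial measure with weights `a` and `b`. -/
def cylWeight (c₁ c₂ : ℕ) (T : ℕ → ℕ) (a b : ℕ → ℝ) (n : ℕ) (w : Word c₁ c₂ T n) : ℝ :=
  ∏ i : Fin n, (if isA T (i.val + 1) then a (w i).val else b (w i).val)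

/-- `θ(q) = log_c (p₁^q + ⋯ + p_c^q)`. -/
def theta (c : ℕ) (p : ℕ → ℝ) (q : ℝ) : ℝ :=
  Real.logb c (∑ i ∈ Finset.range c, p i ^ q)

/-- `τ_{μ,n}(q)`, defined by `∑_{z ∈ 𝒜₁,₂ⁿ} μ([z])^q = |w|^{-τ_{μ,n}(q)}`. -/
def tauN (c₁ c₂ : ℕ) (T : ℕ → ℕ) (a b : ℕ → ℝ) (q : ℝ) (n : ℕ) : ℝ :=
  Real.log (∑ z : Word c₁ c₂ T n, cylWeight c₁ c₂ T a b n z ^ q) /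
    Real.log ((c₁ : ℝ) ^ Ncount T n * (c₂ : ℝ) ^ (n - Ncount T n))

/-- The natural projection `γ : ∂𝒜₁,₂* → [0,1]`,
`γ(ε₁ε₂⋯) = ∑_{n≥1} εₙ c₁^{-N_n} c₂^{-(n-N_n)}`. -/
def gammaMap (c₁ c₂ : ℕ) (T : ℕ → ℕ) (x : Omg c₁ c₂ T) : ℝ :=
  ∑' n : ℕ, ((x n).val : ℝ) * Dw c₁ c₂ T (n + 1)

/-- The normalized weights `pᵢ^q / (p₁^q + ⋯ + p_c^q)`. -/
def taW (c : ℕ) (p : ℕ → ℝ) (q : ℝ) (i : ℕ) : ℝ :=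
  p i ^ q / ∑ j ∈ Finset.range c, p j ^ q

/-- `s₁ = min{max aᵢ, max bⱼ}`. -/
def sOne (c₁ c₂ : ℕ) (a b : ℕ → ℝ) : ℝ :=
  min (sSup {x | ∃ i < c₁, a i = x}) (sSup {x | ∃ j < c₂, b j = x})

/-- `s₂ = max{min aᵢ, min bⱼ}`. -/
def sTwo (c₁ c₂ : ℕ) (a b : ℕ → ℝ) : ℝ :=
  max (sInf {x | ∃ i < c₁, a i = x}) (sInf {x | ∃ j < c₂, b j = x})

/-- Entropy `h(p) = -∑_{i<2} pᵢ log₂ pᵢ`. -/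
def hEnt (p : ℕ → ℝ) : ℝ := -(∑ i ∈ Finset.range 2, p i * Real.logb 2 (p i))

/-! ### Dyadic intervals -/

/-- The family `𝓕_n` of dyadic intervals of generation `n` in `[0,1]`. -/
def Fnfam (n : ℕ) : Set (Set ℝ) :=
  {I | ∃ j : ℕ, j < 2 ^ n ∧ I = Set.Icc ((j : ℝ) / 2 ^ n) (((j : ℝ) + 1) / 2 ^ n)}

/-- Index of the dyadic interval of generation `n` containing `x`
(the left one when `x` is dyadic). -/
def dyadIdx (n : ℕ) (x : ℝ) : ℤ := ⌈x * 2 ^ n⌉ - 1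

/-- `I_n(x)`: the dyadic interval of generation `n` containing `x`
(the left one when `x` is dyadic). -/
def Idyad (n : ℕ) (x : ℝ) : Set ℝ :=
  Set.Icc ((dyadIdx n x : ℝ) / 2 ^ n) (((dyadIdx n x : ℝ) + 1) / 2 ^ n)

/-- `I_n(x)⁺`: the right neighbour of `I_n(x)` in `𝓕_n`. -/
def IdyadP (n : ℕ) (x : ℝ) : Set ℝ :=
  Set.Icc (((dyadIdx n x : ℝ) + 1) / 2 ^ n) (((dyadIdx n x : ℝ) + 2) / 2 ^ n)

/-- `I_n(x)⁻`: the left neighbour of `I_n(x)` in `𝓕_n`. -/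
def IdyadM (n : ℕ) (x : ℝ) : Set ℝ :=
  Set.Icc (((dyadIdx n x : ℝ) - 1) / 2 ^ n) ((dyadIdx n x : ℝ) / 2 ^ n)

/-! ### Symbolic spaces with cylinder-diameter metrics -/

/-- Minus the logarithm of the diameter of a cylinder of generation `n`. -/
def logSize (Y : ℕ → ℕ) (n : ℕ) : ℝ := ∑ i ∈ Finset.range n, Real.log (Y i)

/-- The cylinder of generation `n` around `x`. -/
def prefixSet {Y : ℕ → ℕ} (x : ∀ n, Fin (Y n)) (n : ℕ) : Set (∀ n, Fin (Y n)) :=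
  {y | ∀ i, i < n → y i = x i}

/-- Minus the logarithm of the mass `∏_{i<n} P i (x i)` of the cylinder of generation `n`. -/
def logMass {Y : ℕ → ℕ} (P : ∀ i, Fin (Y i) → ℝ) (n : ℕ) (x : ∀ n, Fin (Y n)) : ℝ :=
  -∑ i ∈ Finset.range n, Real.log (P i (x i))

/-- Points at which the ratio of the logarithms of mass and diameter of cylinders tends to `α`. -/
def expLevel {Y : ℕ → ℕ} (P : ∀ i, Fin (Y i) → ℝ) (α : ℝ) : Set (∀ n, Fin (Y n)) :=
  {x | Tendsto (fun n => logMass P n x / logSize Y n) atTop (𝓝 α)}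

lemma log_two_le_log_size {Y : ℕ → ℕ} (hY : ∀ i, 2 ≤ Y i) (i : ℕ) :
    Real.log 2 ≤ Real.log (Y i) :=
  Real.log_le_log (by norm_num) (by exact_mod_cast hY i)

lemma logSize_strictMono {Y : ℕ → ℕ} (hY : ∀ i, 2 ≤ Y i) : StrictMono (logSize Y) := by
  refine strictMono_nat_of_lt_succ fun n => ?_
  rw [logSize, logSize, Finset.sum_range_succ]
  have := log_two_le_log_size hY n
  have := Real.log_pos (show (1 : ℝ) < 2 by norm_num)
  linarith

lemma mul_log_two_le_logSize {Y : ℕ → ℕ} (hY : ∀ i, 2 ≤ Y i) (n : ℕ) :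
    n * Real.log 2 ≤ logSize Y n := by
  have := Finset.card_nsmul_le_sum (Finset.range n) (fun i => Real.log (Y i)) (Real.log 2)
    fun i _ => log_two_le_log_size hY i
  simpa [logSize] using this

lemma tendsto_logSize {Y : ℕ → ℕ} (hY : ∀ i, 2 ≤ Y i) : Tendsto (logSize Y) atTop atTop :=
  tendsto_atTop_mono (mul_log_two_le_logSize hY)
    (tendsto_natCast_atTop_atTop.atTop_mul_const (Real.log_pos (by norm_num)))

lemma logSize_nonneg (Y : ℕ → ℕ) (n : ℕ) : 0 ≤ logSize Y n :=
  Finset.sum_nonneg fun _ _ => Real.log_natCast_nonneg _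

lemma logSize_pos {Y : ℕ → ℕ} (hY : ∀ i, 2 ≤ Y i) {n : ℕ} (hn : 0 < n) : 0 < logSize Y n := by
  simpa [logSize] using logSize_strictMono hY hn

lemma exists_exp_neg_logSize_le {Y : ℕ → ℕ} (hY : ∀ i, 2 ≤ Y i) {r : ℝ} (h0 : 0 < r)
    (h1 : r < 1) :
    ∃ n, Real.exp (-logSize Y (n + 1)) ≤ r ∧ r < Real.exp (-logSize Y n) := by
  have hex : ∃ n, Real.exp (-logSize Y n) ≤ r := by
    obtain ⟨n, hn⟩ := ((tendsto_logSize hY).eventually_ge_atTop (-Real.log r)).exists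
    refine ⟨n, ?_⟩
    rw [← Real.le_log_iff_exp_le h0]
    linarith
  have hpos : 0 < Nat.find hex := by
    rw [Nat.find_pos]
    simpa [logSize] using h1
  refine ⟨Nat.find hex - 1, ?_, ?_⟩
  · rw [Nat.sub_add_cancel hpos]
    exact Nat.find_spec hex
  · exact not_le.1 (Nat.find_min hex (Nat.sub_lt hpos one_pos))

lemma exists_first_difference {Y : ℕ → ℕ} {x y : ∀ n, Fin (Y n)} (h : x ≠ y) :
    ∃ m, (∀ i, i < m → x i = y i) ∧ x m ≠ y m := by
  have hex : ∃ m, x m ≠ y m := Function.ne_iff.1 h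
  exact ⟨Nat.find hex, fun i hi => not_not.1 (Nat.find_min hex hi), Nat.find_spec hex⟩

lemma sum_words_prod {Y : ℕ → ℕ} {n : ℕ} (f : ∀ i, Fin (Y i) → ℝ) :
    ∑ w : (∀ i : Fin n, Fin (Y i)), ∏ i : Fin n, f i (w i) =
      ∏ i ∈ Finset.range n, ∑ j, f i j := by
  rw [Finset.prod_range fun i => ∑ j, f i j, Finset.prod_univ_sum, Fintype.piFinset_univ]

section Metric

variable {Y : ℕ → ℕ} [MetricSpace (∀ n, Fin (Y n))]

lemma dist_le_exp_neg_logSize (hY : ∀ i, 2 ≤ Y i)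
    (hd : ∀ (x y : ∀ n, Fin (Y n)) (n : ℕ), (∀ i, i < n → x i = y i) → x n ≠ y n →
      dist x y = Real.exp (-logSize Y n)) {x y : ∀ n, Fin (Y n)} {n : ℕ}
    (h : ∀ i, i < n → x i = y i) : dist x y ≤ Real.exp (-logSize Y n) := by
  by_cases hxy : x = y
  · rw [hxy, dist_self]
    positivity
  obtain ⟨m, hm, hne⟩ := exists_first_difference hxy
  rw [hd x y m hm hne, Real.exp_le_exp, neg_le_neg_iff]
  exact (logSize_strictMono hY).monotone (not_lt.1 fun hmn => hne (h m hmn))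

lemma eq_of_dist_lt_exp_neg_logSize (hY : ∀ i, 2 ≤ Y i)
    (hd : ∀ (x y : ∀ n, Fin (Y n)) (n : ℕ), (∀ i, i < n → x i = y i) → x n ≠ y n →
      dist x y = Real.exp (-logSize Y n)) {x y : ∀ n, Fin (Y n)} {n : ℕ}
    (h : dist x y < Real.exp (-logSize Y n)) {i : ℕ} (hi : i < n + 1) : x i = y i := by
  by_cases hxy : x = y
  · rw [hxy]
  obtain ⟨m, hm, hne⟩ := exists_first_difference hxy
  rw [hd x y m hm hne, Real.exp_lt_exp, neg_lt_neg_iff] at h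
  have := (logSize_strictMono hY).lt_iff_lt.1 h
  exact hm i (by omega)

lemma closedBall_eq_prefixSet (hY : ∀ i, 2 ≤ Y i)
    (hd : ∀ (x y : ∀ n, Fin (Y n)) (n : ℕ), (∀ i, i < n → x i = y i) → x n ≠ y n →
      dist x y = Real.exp (-logSize Y n)) (x : ∀ n, Fin (Y n)) {n : ℕ} {r : ℝ}
    (h₁ : Real.exp (-logSize Y (n + 1)) ≤ r) (h₂ : r < Real.exp (-logSize Y n)) :
    closedBall x r = prefixSet x (n + 1) := by
  ext y
  rw [mem_closedBall]
  exact ⟨fun h i hi => eq_of_dist_lt_exp_neg_logSize hY hd (h.trans_lt h₂) hi,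
    fun h => (dist_le_exp_neg_logSize hY hd h).trans h₁⟩

lemma prefixSet_subset_ball (hY : ∀ i, 2 ≤ Y i)
    (hd : ∀ (x y : ∀ n, Fin (Y n)) (n : ℕ), (∀ i, i < n → x i = y i) → x n ≠ y n →
      dist x y = Real.exp (-logSize Y n)) (x : ∀ n, Fin (Y n)) {r : ℝ} (hr : 0 < r) :
    ∃ n, prefixSet x n ⊆ ball x r := by
  obtain ⟨n, hn⟩ := ((tendsto_logSize hY).eventually_gt_atTop (-Real.log r)).exists
  refine ⟨n, fun y hy => mem_ball.2 ((dist_le_exp_neg_logSize hY hd hy).trans_lt ?_)⟩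
  rw [← Real.lt_log_iff_exp_lt hr]
  linarith

lemma borelSpace_of_dist_eq (hY : ∀ i, 2 ≤ Y i)
    (hd : ∀ (x y : ∀ n, Fin (Y n)) (n : ℕ), (∀ i, i < n → x i = y i) → x n ≠ y n →
      dist x y = Real.exp (-logSize Y n)) :
    @BorelSpace (∀ n, Fin (Y n)) UniformSpace.toTopologicalSpace MeasurableSpace.pi := by
  refine @BorelSpace.mk _ UniformSpace.toTopologicalSpace MeasurableSpace.pi (le_antisymm ?_ ?_)
  · refine iSup_le fun i => ?_
    rintro _ ⟨s, -, rfl⟩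
    refine MeasurableSpace.measurableSet_generateFrom ?_
    refine Metric.isOpen_iff.2 fun x hx => ⟨Real.exp (-logSize Y i), Real.exp_pos _, ?_⟩
    intro y hy
    have := eq_of_dist_lt_exp_neg_logSize hY hd (mem_ball.1 hy) (Nat.lt_succ_self i)
    simpa [this] using hx
  · refine MeasurableSpace.generateFrom_le fun U hU => ?_
    have hU' := Metric.isOpen_iff.1 hU
    have : U = ⋃ (p : Σ n : ℕ, ∀ i : Fin n, Fin (Y i))
        (_ : {y : ∀ n, Fin (Y n) | ∀ i : Fin p.1, y i = p.2 i} ⊆ U),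
        {y : ∀ n, Fin (Y n) | ∀ i : Fin p.1, y i = p.2 i} := by
      refine Set.Subset.antisymm (fun x hx => ?_) (iUnion₂_subset fun _ h => h)
      obtain ⟨r, hr, hrU⟩ := hU' x hx
      obtain ⟨n, hn⟩ := prefixSet_subset_ball hY hd x hr
      refine mem_iUnion₂.2 ⟨⟨n, fun i => x i⟩, fun y hy => hrU (hn fun i hi => hy ⟨i, hi⟩), ?_⟩
      exact fun _ => rfl
    rw [this]
    refine MeasurableSet.iUnion fun p => MeasurableSet.iUnion fun _ => ?_
    have : {y : ∀ n, Fin (Y n) | ∀ i : Fin p.1, y i = p.2 i} =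
        ⋂ i : Fin p.1, {y : ∀ n, Fin (Y n) | y i = p.2 i} := by
      ext y
      simp
    rw [this]
    exact MeasurableSet.iInter fun i =>
      (measurable_pi_apply (i : ℕ) : Measurable fun y : (∀ n, Fin (Y n)) => y i)
        (measurableSet_singleton (p.2 i))

lemma ediam_prefixSet_le (hY : ∀ i, 2 ≤ Y i)
    (hd : ∀ (x y : ∀ n, Fin (Y n)) (n : ℕ), (∀ i, i < n → x i = y i) → x n ≠ y n →
      dist x y = Real.exp (-logSize Y n)) (n : ℕ) {s : Set (∀ n, Fin (Y n))}
    (hs : ∀ x ∈ s, ∀ y ∈ s, ∀ i, i < n → x i = y i) :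
    ediam s ≤ ENNReal.ofReal (Real.exp (-logSize Y n)) := by
  refine Metric.ediam_le fun x hx y hy => ?_
  rw [edist_dist]
  exact ENNReal.ofReal_le_ofReal (dist_le_exp_neg_logSize hY hd (hs x hx y hy))

/-- A mass distribution principle on symbolic spaces. -/
lemma ofReal_le_dimH_of_measure_prefixSet_le (hY : ∀ i, 2 ≤ Y i)
    (hd : ∀ (x y : ∀ n, Fin (Y n)) (n : ℕ), (∀ i, i < n → x i = y i) → x n ≠ y n →
      dist x y = Real.exp (-logSize Y n)) (ν : Measure (∀ n, Fin (Y n)))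
    [IsProbabilityMeasure ν] {G : Set (∀ n, Fin (Y n))} (hG : ∀ᵐ x ∂ν, x ∈ G) (t : ℝ)
    (ht : ∀ᵐ x ∂ν, ∀ᶠ n in atTop,
      ν (prefixSet x n) ≤ ENNReal.ofReal (Real.exp (-(t * logSize Y n)))) :
    ENNReal.ofReal t ≤ dimH G := by
  rcases le_or_gt t 0 with ht0 | ht0
  · simp [ENNReal.ofReal_of_nonpos ht0]
  have := borelSpace_of_dist_eq hY hd
  set F : ℕ → Set (∀ n, Fin (Y n)) := fun K =>
    {x | ∀ n, K ≤ n → ν (prefixSet x n) ≤ ENNReal.ofReal (Real.exp (-(t * logSize Y n)))} with hF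
  have hmeas : ∀ K, MeasurableSet (F K) := by
    intro K
    have hfun : ∀ n, Measurable fun x : (∀ n, Fin (Y n)) => ν (prefixSet x n) := by
      intro n
      have h1 : Measurable fun (x : ∀ n, Fin (Y n)) (i : Fin n) => x i :=
        measurable_pi_lambda _ fun i => measurable_pi_apply _
      have h2 : Measurable fun w : (∀ i : Fin n, Fin (Y i)) =>
          ν {y | ∀ i, ∀ h : i < n, y i = w ⟨i, h⟩} := Measurable.of_discrete
      exact h2.comp h1
    have : F K = ⋂ (n : ℕ) (_ : K ≤ n), {x | ν (prefixSet x n) ≤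
        ENNReal.ofReal (Real.exp (-(t * logSize Y n)))} := by
      ext x
      simp [hF]
    rw [this]
    exact MeasurableSet.iInter fun n => MeasurableSet.iInter fun _ =>
      measurableSet_le (hfun n) measurable_const
  obtain ⟨K, hK⟩ : ∃ K, ν (F K) ≠ 0 := by
    by_contra! h
    have h0 : ν (⋃ K, F K) = 0 := measure_iUnion_null h
    have h1 : ∀ᵐ x ∂ν, x ∈ ⋃ K, F K := by
      filter_upwards [ht] with x hx
      exact mem_iUnion.2 (eventually_atTop.1 hx)
    have h2 : ∀ᵐ x ∂ν, x ∉ ⋃ K, F K := measure_eq_zero_iff_ae_notMem.1 h0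
    obtain ⟨x, hx1, hx2⟩ := (h1.and h2).exists
    exact hx2 hx1
  have hle : ν.restrict (F K) ≤ Measure.hausdorffMeasure t := by
    refine Measure.le_hausdorffMeasure t _ (ENNReal.ofReal (Real.exp (-logSize Y (K + 1))))
      (by simp [Real.exp_pos]) fun s hs => ?_
    rw [Measure.restrict_apply' (hmeas K)]
    rcases (s ∩ F K).eq_empty_or_nonempty with he | ⟨x, hxs, hxF⟩
    · simp [he]
    have hfin : ediam s ≠ ⊤ := ne_top_of_le_ne_top ENNReal.ofReal_ne_top hs
    have hsub : ∀ y ∈ s, edist y x ≤ ediam s := fun y hy => Metric.edist_le_ediam_of_mem hy hxs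
    rcases eq_or_ne (ediam s) 0 with h0 | h0
    · have hall : ∀ n, K ≤ n → ν (s ∩ F K) ≤
          ENNReal.ofReal (Real.exp (-(t * logSize Y n))) := by
        intro n hn
        refine (measure_mono ?_).trans (hxF n hn)
        rintro y ⟨hy, -⟩ i -
        have := hsub y hy
        rw [h0, nonpos_iff_eq_zero, edist_eq_zero] at this
        rw [this]
      have hlim : Tendsto (fun n => ENNReal.ofReal (Real.exp (-(t * logSize Y n)))) atTop
          (𝓝 0) := by
        rw [← ENNReal.ofReal_zero]
        refine ENNReal.tendsto_ofReal (Real.tendsto_exp_neg_atTop_nhds_zero.comp ?_)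
        exact (tendsto_logSize hY).const_mul_atTop ht0
      exact (ge_of_tendsto hlim (eventually_atTop.2 ⟨K, hall⟩)).trans zero_le
    · set r := (ediam s).toReal with hr
      have hr0 : 0 < r := ENNReal.toReal_pos h0 hfin
      have hrK : r ≤ Real.exp (-logSize Y (K + 1)) :=
        ENNReal.toReal_le_of_le_ofReal (Real.exp_pos _).le hs
      have hr1 : r < Real.exp (-logSize Y K) := by
        refine hrK.trans_lt ?_
        rw [Real.exp_lt_exp, neg_lt_neg_iff]
        exact logSize_strictMono hY (Nat.lt_succ_self K)
      obtain ⟨n, hn1, hn2⟩ := exists_exp_neg_logSize_le hY hr0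
        (hr1.trans_le (by simpa using logSize_nonneg Y K))
      have hKn : K ≤ n + 1 := by
        have : Real.exp (-logSize Y (n + 1)) < Real.exp (-logSize Y K) := hn1.trans_lt hr1
        rw [Real.exp_lt_exp, neg_lt_neg_iff] at this
        exact ((logSize_strictMono hY).lt_iff_lt.1 this).le
      have hss : s ∩ F K ⊆ prefixSet x (n + 1) := by
        rw [← closedBall_eq_prefixSet hY hd x hn1 hn2]
        rintro y ⟨hy, -⟩
        have := hsub y hy
        rw [edist_dist, ← ENNReal.ofReal_toReal hfin,
          ENNReal.ofReal_le_ofReal_iff ENNReal.toReal_nonneg] at this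
        exact this
      refine (measure_mono hss).trans ((hxF _ hKn).trans ?_)
      rw [← ENNReal.ofReal_toReal hfin, ENNReal.ofReal_rpow_of_nonneg ENNReal.toReal_nonneg ht0.le]
      refine ENNReal.ofReal_le_ofReal ?_
      calc Real.exp (-(t * logSize Y (n + 1))) = Real.exp (-logSize Y (n + 1)) ^ t := by
            rw [← Real.exp_mul]
            ring_nf
        _ ≤ r ^ t := Real.rpow_le_rpow (Real.exp_pos _).le hn1 ht0.le
  refine le_dimH_of_hausdorffMeasure_ne_zero (d := t.toNNReal) ?_
  rw [Real.coe_toNNReal _ ht0.le]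
  intro hzero
  have h0 : ν.restrict (F K) G = 0 := le_antisymm ((hle G).trans hzero.le) zero_le
  have h1 : ∀ᵐ x ∂ν.restrict (F K), x ∈ G := ae_restrict_of_ae hG
  have h2 : ν.restrict (F K) Set.univ = 0 := by
    have h3 : ν.restrict (F K) Gᶜ = 0 := h1
    rw [← Set.union_compl_self G]
    exact measure_union_null h0 h3
  rw [Measure.restrict_apply_univ] at h2
  exact hK h2

lemma Xlev_eq_expLevel (hY : ∀ i, 2 ≤ Y i)
    (hd : ∀ (x y : ∀ n, Fin (Y n)) (n : ℕ), (∀ i, i < n → x i = y i) → x n ≠ y n →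
      dist x y = Real.exp (-logSize Y n)) {C : ℝ} (hC : ∀ i, Real.log (Y i) ≤ C)
    (P : ∀ i, Fin (Y i) → ℝ) (μ : Measure (∀ n, Fin (Y n)))
    (hμ : ∀ x n, μ (prefixSet x n) = ENNReal.ofReal (Real.exp (-logMass P n x))) (α : ℝ) :
    Xlev μ α = expLevel P α := by
  have hmass : ∀ (x : ∀ n, Fin (Y n)) (n : ℕ) (r : ℝ), Real.exp (-logSize Y (n + 1)) ≤ r →
      r < Real.exp (-logSize Y n) →
      Real.log (μ (closedBall x r)).toReal = -logMass P (n + 1) x := by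
    intro x n r h1 h2
    rw [closedBall_eq_prefixSet hY hd x h1 h2, hμ, ENNReal.toReal_ofReal (Real.exp_pos _).le,
      Real.log_exp]
  ext x
  constructor
  · rintro ⟨-, hx⟩
    rw [expLevel, mem_ofPred_eq, ← tendsto_add_atTop_iff_nat 1]
    have hr : Tendsto (fun n => Real.exp (-logSize Y (n + 1))) atTop (𝓝[>] 0) := by
      refine tendsto_nhdsWithin_iff.2 ⟨?_, Eventually.of_forall fun n => Real.exp_pos _⟩
      exact Real.tendsto_exp_neg_atTop_nhds_zero.comp
        ((tendsto_logSize hY).comp (tendsto_add_atTop_nat 1))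
    refine (hx.comp hr).congr fun n => ?_
    have hlt : Real.exp (-logSize Y (n + 1)) < Real.exp (-logSize Y n) := by
      rw [Real.exp_lt_exp, neg_lt_neg_iff]
      exact logSize_strictMono hY (Nat.lt_succ_self n)
    rw [Function.comp_apply, hmass x n _ le_rfl hlt, Real.log_exp, neg_div_neg_eq]
  · intro hx
    refine ⟨fun r hr => ?_, ?_⟩
    · obtain ⟨n, hn⟩ := prefixSet_subset_ball hY hd x hr
      refine lt_of_lt_of_le ?_ (measure_mono hn)
      rw [hμ]
      simp [Real.exp_pos]
    · have hex : ∀ r : ℝ, ∃ n, r ∈ Ioo (0 : ℝ) 1 →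
          Real.exp (-logSize Y (n + 1)) ≤ r ∧ r < Real.exp (-logSize Y n) := by
        intro r
        by_cases hr : r ∈ Ioo (0 : ℝ) 1
        · obtain ⟨n, hn⟩ := exists_exp_neg_logSize_le hY hr.1 hr.2
          exact ⟨n, fun _ => hn⟩
        · exact ⟨0, fun h => absurd h hr⟩
      choose N hN using hex
      have hsmall : ∀ᶠ r in 𝓝[>] (0 : ℝ), r ∈ Ioo (0 : ℝ) 1 := Ioo_mem_nhdsGT one_pos
      have hNtop : Tendsto (fun r => N r + 1) (𝓝[>] (0 : ℝ)) atTop := by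
        refine tendsto_atTop.2 fun k => ?_
        filter_upwards [Ioo_mem_nhdsGT (Real.exp_pos (-logSize Y k)), hsmall] with r hr hr1
        have := (hN r hr1).1.trans_lt hr.2
        rw [Real.exp_lt_exp, neg_lt_neg_iff] at this
        exact ((logSize_strictMono hY).lt_iff_lt.1 this).le
      have hratio : Tendsto (fun r => logSize Y (N r + 1) / -Real.log r) (𝓝[>] (0 : ℝ))
          (𝓝 1) := by
        have hlog : Tendsto (fun r => -Real.log r) (𝓝[>] (0 : ℝ)) atTop :=
          tendsto_neg_atBot_atTop.comp Real.tendsto_log_nhdsGT_zero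
        have hup : Tendsto (fun r => 1 + C / -Real.log r) (𝓝[>] (0 : ℝ)) (𝓝 1) := by
          simpa using (tendsto_const_nhds (x := (1 : ℝ))).add (hlog.const_div_atTop C)
        refine tendsto_of_tendsto_of_tendsto_of_le_of_le' tendsto_const_nhds hup ?_ ?_
        · filter_upwards [hsmall] with r hr
          have h1 : 0 < -Real.log r := neg_pos.2 (Real.log_neg hr.1 hr.2)
          rw [le_div_iff₀ h1]
          have := (Real.le_log_iff_exp_le hr.1).2 (hN r hr).1
          linarith
        · filter_upwards [hsmall] with r hr
          have h1 : 0 < -Real.log r := neg_pos.2 (Real.log_neg hr.1 hr.2)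
          rw [div_le_iff₀ h1, add_mul, div_mul_cancel₀ _ h1.ne', logSize, Finset.sum_range_succ]
          have h2 := (Real.log_lt_iff_lt_exp hr.1).2 (hN r hr).2
          have h3 := hC (N r)
          rw [logSize] at h2
          linarith
      have hlim := (hx.comp hNtop).mul hratio
      rw [mul_one] at hlim
      refine hlim.congr' ?_
      filter_upwards [hsmall] with r hr
      rw [hmass x (N r) r (hN r hr).1 (hN r hr).2, Function.comp_apply,
        div_mul_div_cancel₀ (logSize_pos hY (Nat.succ_pos _)).ne', div_neg, neg_div]

/-- A first-moment covering bound for level sets. -/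
lemma dimH_expLevel_le (hY : ∀ i, 2 ≤ Y i)
    (hd : ∀ (x y : ∀ n, Fin (Y n)) (n : ℕ), (∀ i, i < n → x i = y i) → x n ≠ y n →
      dist x y = Real.exp (-logSize Y n)) (P : ∀ i, Fin (Y i) → ℝ) (hP : ∀ i j, 0 < P i j)
    (α q θ : ℝ) {φ : ℕ → ℕ} (hφ : Tendsto φ atTop atTop)
    (hθ : Tendsto (fun k => (∑ i ∈ Finset.range (φ k), Real.log (∑ j, P i j ^ q)) /
      logSize Y (φ k)) atTop (𝓝 θ)) :
    dimH (expLevel P α) ≤ ENNReal.ofReal (α * q + θ) := by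
  have := borelSpace_of_dist_eq hY hd
  refine dimH_le fun t htop => ?_
  by_contra! hlt
  have ht0 : (0 : ℝ) < t := by
    have : (0 : ℝ≥0∞) < t := lt_of_le_of_lt zero_le hlt
    exact_mod_cast this
  have hvt : α * q + θ < t := by
    by_contra! h
    have := ENNReal.ofReal_le_ofReal h
    rw [ENNReal.ofReal_coe_nnreal] at this
    exact absurd hlt (not_lt.2 this)
  set δ : ℝ := (t - (α * q + θ)) / 3 with hδ
  have hδ0 : 0 < δ := by
    rw [hδ]
    linarith
  set ε : ℝ := δ / (|q| + 1) with hε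
  have hε0 : 0 < ε := by positivity
  have hεq : ε * |q| ≤ δ := by
    rw [hε, div_mul_eq_mul_div, div_le_iff₀ (by positivity)]
    nlinarith [abs_nonneg q]
  set E : ℕ → Set (∀ n, Fin (Y n)) := fun K =>
    {x | ∀ n, K ≤ n → |logMass P n x - α * logSize Y n| ≤ ε * logSize Y n} with hE
  have hsub : expLevel P α ⊆ ⋃ K, E K := by
    intro x hx
    have h1 : ∀ᶠ n in atTop, |logMass P n x / logSize Y n - α| < ε := by
      simpa [Real.dist_eq] using (Metric.tendsto_nhds.1 hx) ε hε0
    obtain ⟨K, hK⟩ := eventually_atTop.1 (h1.and (eventually_gt_atTop 0))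
    refine mem_iUnion.2 ⟨K, fun n hn => ?_⟩
    have hpos := logSize_pos hY (hK n hn).2
    have h2 := (hK n hn).1
    have h3 : logMass P n x - α * logSize Y n =
        (logMass P n x / logSize Y n - α) * logSize Y n := by
      field_simp
    rw [h3, abs_mul, abs_of_pos hpos]
    exact mul_le_mul_of_nonneg_right h2.le hpos.le
  have hzero : ∀ K, Measure.hausdorffMeasure (t : ℝ) (E K) = 0 := by
    intro K
    set W : ∀ n, (∀ i : Fin n, Fin (Y i)) → Set (∀ n, Fin (Y n)) := fun n w =>
      {x | (∀ i : Fin n, x i = w i) ∧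
        |logMass P n x - α * logSize Y n| ≤ ε * logSize Y n} with hW
    have hr : Tendsto (fun k => ENNReal.ofReal (Real.exp (-logSize Y (φ k)))) atTop (𝓝 0) := by
      rw [← ENNReal.ofReal_zero]
      exact ENNReal.tendsto_ofReal (Real.tendsto_exp_neg_atTop_nhds_zero.comp
        ((tendsto_logSize hY).comp hφ))
    have hdiam : ∀ n w, ediam (W n w) ≤ ENNReal.ofReal (Real.exp (-logSize Y n)) := by
      intro n w
      refine ediam_prefixSet_le hY hd n fun x hx y hy i hi => ?_
      rw [hx.1 ⟨i, hi⟩, hy.1 ⟨i, hi⟩]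
    have hcov : ∀ᶠ k in atTop, E K ⊆ ⋃ w, W (φ k) w := by
      filter_upwards [hφ.eventually_ge_atTop K] with k hk x hx
      exact mem_iUnion.2 ⟨fun i => x i, fun _ => rfl, hx _ hk⟩
    have hbound := Measure.hausdorffMeasure_le_liminf_sum (t : ℝ) (E K) (l := atTop)
      (fun k => ENNReal.ofReal (Real.exp (-logSize Y (φ k)))) hr (fun k => W (φ k))
      (Eventually.of_forall fun k => hdiam (φ k)) hcov
    have hsum : ∀ᶠ k in atTop, ∑ w, ediam (W (φ k) w) ^ (t : ℝ) ≤
        ENNReal.ofReal (Real.exp (-(δ * logSize Y (φ k)))) := by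
      have hθ' : ∀ᶠ k in atTop, (∑ i ∈ Finset.range (φ k), Real.log (∑ j, P i j ^ q)) /
          logSize Y (φ k) < θ + δ := hθ.eventually_lt_const (by linarith)
      filter_upwards [hθ', hφ.eventually_gt_atTop 0] with k hk hk0
      set n := φ k with hn
      have hpos := logSize_pos hY hk0
      set l := logSize Y n with hl
      have hterm : ∀ w : (∀ i : Fin n, Fin (Y i)), ediam (W n w) ^ (t : ℝ) ≤
          ENNReal.ofReal (Real.exp (-(t * l) + (α * q + δ) * l) *
            ∏ i : Fin n, P i (w i) ^ q) := by
        intro w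
        rcases (W n w).eq_empty_or_nonempty with he | ⟨x, hxw, hx⟩
        · simp [he, ENNReal.zero_rpow_of_pos ht0]
        have hprod : ∏ i : Fin n, P i (w i) ^ q = Real.exp (-(q * logMass P n x)) := by
          have h1 : ∀ i : Fin n, P i (w i) ^ q = Real.exp (Real.log (P i (x i)) * q) := by
            intro i
            rw [← hxw i, Real.rpow_def_of_pos (hP _ _)]
          rw [Finset.prod_congr rfl fun i _ => h1 i, ← Real.exp_sum, logMass,
            Finset.sum_range fun i => Real.log (P i (x i)), ← Finset.sum_mul]
          ring_nf
        refine (ENNReal.rpow_le_rpow (hdiam n w) ht0.le).trans ?_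
        rw [ENNReal.ofReal_rpow_of_pos (Real.exp_pos _), hprod, ← Real.exp_mul, ← Real.exp_add]
        refine ENNReal.ofReal_le_ofReal (Real.exp_le_exp.2 ?_)
        have h1 : q * (logMass P n x - α * l) ≤ δ * l := by
          calc q * (logMass P n x - α * l) ≤ |q * (logMass P n x - α * l)| := le_abs_self _
            _ = |q| * |logMass P n x - α * l| := abs_mul _ _
            _ ≤ |q| * (ε * l) := mul_le_mul_of_nonneg_left hx (abs_nonneg _)
            _ = ε * |q| * l := by ring
            _ ≤ δ * l := mul_le_mul_of_nonneg_right hεq hpos.le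
        linarith
      refine (Finset.sum_le_sum fun w _ => hterm w).trans ?_
      rw [← ENNReal.ofReal_sum_of_nonneg fun w _ => mul_nonneg (Real.exp_pos _).le
        (Finset.prod_nonneg fun i _ => Real.rpow_nonneg (hP _ _).le _), ← Finset.mul_sum,
        sum_words_prod fun i j => P i j ^ q]
      refine ENNReal.ofReal_le_ofReal ?_
      have hZ : ∀ i, 0 < ∑ j, P i j ^ q := fun i =>
        Finset.sum_pos (fun j _ => Real.rpow_pos_of_pos (hP i j) q)
          ⟨⟨0, by have := hY i; omega⟩, Finset.mem_univ _⟩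
      have hZprod : ∏ i ∈ Finset.range n, ∑ j, P i j ^ q =
          Real.exp (∑ i ∈ Finset.range n, Real.log (∑ j, P i j ^ q)) := by
        rw [Real.exp_sum]
        exact Finset.prod_congr rfl fun i _ => (Real.exp_log (hZ i)).symm
      rw [hZprod, ← Real.exp_add, Real.exp_le_exp]
      rw [div_lt_iff₀ hpos] at hk
      have h3 : (t : ℝ) = α * q + θ + 3 * δ := by
        rw [hδ]
        ring
      rw [h3]
      linarith
    refine le_antisymm (hbound.trans ?_) zero_le
    have hlim : Tendsto (fun k => ENNReal.ofReal (Real.exp (-(δ * logSize Y (φ k))))) atTop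
        (𝓝 0) := by
      rw [← ENNReal.ofReal_zero]
      refine ENNReal.tendsto_ofReal (Real.tendsto_exp_neg_atTop_nhds_zero.comp ?_)
      exact ((tendsto_logSize hY).comp hφ).const_mul_atTop hδ0
    exact (liminf_le_liminf hsum).trans hlim.liminf_eq.le
  have hnull : Measure.hausdorffMeasure (t : ℝ) (expLevel P α) = 0 :=
    measure_mono_null hsub (measure_iUnion_null hzero)
  rw [hnull] at htop
  exact ENNReal.zero_ne_top htop

end Metric

/-! ### Product measures -/

/-- The probability measure on `Fin m` with weights `p`. -/
def finMeasure {m : ℕ} (p : Fin m → ℝ) : Measure (Fin m) :=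
  ∑ j, ENNReal.ofReal (p j) • Measure.dirac j

lemma finMeasure_singleton {m : ℕ} (p : Fin m → ℝ) (j : Fin m) :
    finMeasure p {j} = ENNReal.ofReal (p j) := by
  simp [finMeasure, Measure.finsetSum_apply, Set.indicator_apply]

lemma isProbabilityMeasure_finMeasure {m : ℕ} {p : Fin m → ℝ} (h0 : ∀ j, 0 ≤ p j)
    (h1 : ∑ j, p j = 1) : IsProbabilityMeasure (finMeasure p) := by
  constructor
  simp [finMeasure, Measure.finsetSum_apply, ← ENNReal.ofReal_sum_of_nonneg fun j _ => h0 j, h1]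

lemma integral_finMeasure {m : ℕ} {p : Fin m → ℝ} (h0 : ∀ j, 0 ≤ p j) (g : Fin m → ℝ) :
    ∫ j, g j ∂finMeasure p = ∑ j, p j * g j := by
  rw [finMeasure, integral_finsetSum_measure fun j _ =>
    (integrable_dirac (by simp)).smul_measure ENNReal.ofReal_ne_top]
  simp [integral_smul_measure, h0]

section Product

open ProbabilityTheory

variable {Y : ℕ → ℕ} (ρ : ∀ i, Measure (Fin (Y i))) [∀ i, IsProbabilityMeasure (ρ i)]

lemma ae_eventually_sum_lt (g : ∀ i, Fin (Y i) → ℝ) {B : ℝ} (hB : ∀ i j, |g i j| ≤ B)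
    (hg : ∀ i, ∫ j, g i j ∂ρ i = 0) {ε : ℝ} (hε : 0 < ε) :
    ∀ᵐ x ∂Measure.infinitePi ρ, ∀ᶠ n : ℕ in atTop,
      ∑ i ∈ Finset.range n, g i (x i) < ε * n := by
  set ν := Measure.infinitePi ρ with hν
  have hgm : ∀ i, Measurable (g i) := fun i => Measurable.of_discrete
  have hind : iIndepFun (fun i (x : ∀ n, Fin (Y n)) => g i (x i)) ν := iIndepFun_infinitePi hgm
  set c : ℝ≥0 := (‖(B + 1) - -(B + 1)‖₊ / 2) ^ 2 with hc
  have hB0 : 0 ≤ B := by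
    obtain ⟨j⟩ : Nonempty (Fin (Y 0)) := (ρ 0).nonempty_of_neZero
    exact (abs_nonneg _).trans (hB 0 j)
  have hc0 : (0 : ℝ) < c := by
    have : (0 : ℝ) < ‖(B + 1) - -(B + 1)‖ := norm_pos_iff.2 (by linarith)
    rw [hc]
    push_cast
    positivity
  have hsg : ∀ i, HasSubgaussianMGF (fun x : (∀ n, Fin (Y n)) => g i (x i)) c ν := by
    intro i
    have hm : Measurable fun x : (∀ n, Fin (Y n)) => g i (x i) :=
      (hgm i).comp (measurable_pi_apply i)
    have h := hasSubgaussianMGF_of_mem_Icc (μ := ν) (a := -(B + 1)) (b := B + 1)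
      hm.aemeasurable (Eventually.of_forall fun x => by
        have := abs_le.1 (hB i (x i))
        exact ⟨by linarith [this.1], by linarith [this.2]⟩)
    have hzero : ∫ x, g i (x i) ∂ν = 0 := by
      rw [← hg i, ← (measurePreserving_eval_infinitePi ρ i).map_eq,
        integral_map (measurable_pi_apply i).aemeasurable (hgm i).aestronglyMeasurable]
    rw [hzero] at h
    simpa only [sub_zero] using h
  set s : ℕ → Set (∀ n, Fin (Y n)) :=
    fun n => {x | ε * n ≤ ∑ i ∈ Finset.range n, g i (x i)} with hs
  have hbound : ∀ n, ν (s n) ≤ ENNReal.ofReal (Real.exp (-(ε ^ 2 / (2 * c))) ^ n) := by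
    intro n
    have h := HasSubgaussianMGF.measure_sum_range_ge_le_of_iIndepFun hind (n := n)
      (fun i _ => hsg i) (ε := ε * n) (by positivity)
    rw [← ofReal_measureReal]
    refine ENNReal.ofReal_le_ofReal (h.trans ?_)
    rw [← Real.exp_nat_mul]
    refine le_of_eq (congrArg _ ?_)
    rcases eq_or_ne n 0 with rfl | hn
    · simp
    · have : (n : ℝ) ≠ 0 := by exact_mod_cast hn
      field_simp
  have hsum : ∑' n, ν (s n) ≠ ⊤ := by
    refine ne_top_of_le_ne_top ?_ (ENNReal.tsum_le_tsum hbound)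
    refine (Summable.tsum_ofReal_ne_top ?_)
    refine summable_geometric_of_lt_one (Real.exp_pos _).le ?_
    rw [Real.exp_lt_one_iff]
    have : 0 < ε ^ 2 / (2 * c) := by positivity
    linarith
  filter_upwards [ae_eventually_notMem hsum] with x hx
  filter_upwards [hx] with n hn
  simpa [hs] using hn

/-- A strong law of large numbers for bounded centred functions of independent coordinates. -/
lemma ae_tendsto_sum_div_logSize (hY : ∀ i, 2 ≤ Y i) (g : ∀ i, Fin (Y i) → ℝ) {B : ℝ}
    (hB : ∀ i j, |g i j| ≤ B) (hg : ∀ i, ∫ j, g i j ∂ρ i = 0) :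
    ∀ᵐ x ∂Measure.infinitePi ρ,
      Tendsto (fun n => (∑ i ∈ Finset.range n, g i (x i)) / logSize Y n) atTop (𝓝 0) := by
  have h1 : ∀ᵐ x ∂Measure.infinitePi ρ, ∀ k : ℕ, ∀ᶠ n : ℕ in atTop,
      ∑ i ∈ Finset.range n, g i (x i) < 1 / ((k : ℝ) + 1) * n :=
    ae_all_iff.2 fun k => ae_eventually_sum_lt ρ g hB hg Nat.one_div_pos_of_nat
  have h2 : ∀ᵐ x ∂Measure.infinitePi ρ, ∀ k : ℕ, ∀ᶠ n : ℕ in atTop,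
      ∑ i ∈ Finset.range n, -g i (x i) < 1 / ((k : ℝ) + 1) * n :=
    ae_all_iff.2 fun k => ae_eventually_sum_lt ρ (fun i j => -g i j) (B := B)
      (by simpa using hB) (fun i => by simp [integral_neg, hg i]) Nat.one_div_pos_of_nat
  filter_upwards [h1, h2] with x hx1 hx2
  refine Metric.tendsto_nhds.2 fun ε hε => ?_
  have hlog2 : 0 < Real.log 2 := Real.log_pos (by norm_num)
  obtain ⟨k, hk⟩ := exists_nat_one_div_lt (mul_pos hε hlog2)
  filter_upwards [hx1 k, hx2 k, eventually_gt_atTop 0] with n hn1 hn2 hn0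
  have hpos := logSize_pos hY hn0
  rw [Finset.sum_neg_distrib] at hn2
  have hle : 1 / ((k : ℝ) + 1) * n ≤ ε * logSize Y n := by
    have h3 := mul_log_two_le_logSize hY n
    calc 1 / ((k : ℝ) + 1) * n ≤ ε * Real.log 2 * n :=
          mul_le_mul_of_nonneg_right hk.le (Nat.cast_nonneg n)
      _ = ε * (n * Real.log 2) := by ring
      _ ≤ ε * logSize Y n := mul_le_mul_of_nonneg_left h3 hε.le
  rw [Real.dist_eq, sub_zero, abs_div, abs_of_pos hpos, div_lt_iff₀ hpos, abs_lt]
  constructor <;> linarith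

lemma infinitePi_prefixSet (x : ∀ n, Fin (Y n)) (n : ℕ) :
    Measure.infinitePi ρ (prefixSet x n) = ∏ i ∈ Finset.range n, ρ i {x i} := by
  rw [← Measure.infinitePi_pi ρ (s := Finset.range n) (t := fun i => {x i})
    fun i _ => measurableSet_singleton _]
  congr 1
  ext y
  simp [prefixSet, Set.mem_pi]

end Product

/-- Lower bound for level sets through auxiliary product measures. -/
lemma ofReal_le_dimH_expLevel {Y : ℕ → ℕ} [MetricSpace (∀ n, Fin (Y n))] (hY : ∀ i, 2 ≤ Y i)
    (hd : ∀ (x y : ∀ n, Fin (Y n)) (n : ℕ), (∀ i, i < n → x i = y i) → x n ≠ y n →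
      dist x y = Real.exp (-logSize Y n)) (P p : ∀ i, Fin (Y i) → ℝ) {B : ℝ}
    (hp0 : ∀ i j, 0 ≤ p i j) (hp1 : ∀ i, ∑ j, p i j = 1)
    {α s : ℝ} (hmean : ∀ i, ∑ j, p i j * Real.log (P i j) = -(α * Real.log (Y i)))
    (hent : ∀ i, s * Real.log (Y i) ≤ ∑ j, Real.negMulLog (p i j))
    (hB₁ : ∀ i j, |Real.log (P i j) + α * Real.log (Y i)| ≤ B)
    (hB₂ : ∀ i j, |Real.log (p i j) + ∑ j', Real.negMulLog (p i j')| ≤ B) :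
    ENNReal.ofReal s ≤ dimH (expLevel P α) := by
  set ρ : ∀ i, Measure (Fin (Y i)) := fun i => finMeasure (p i) with hρ
  have : ∀ i, IsProbabilityMeasure (ρ i) := fun i =>
    isProbabilityMeasure_finMeasure (hp0 i) (hp1 i)
  set ν := Measure.infinitePi ρ with hν
  have hS := ae_tendsto_sum_div_logSize ρ hY
    (fun i j => Real.log (P i j) + α * Real.log (Y i)) hB₁ fun i => by
      rw [hρ, integral_finMeasure (hp0 i)]
      simp only [mul_add, Finset.sum_add_distrib, ← Finset.sum_mul, hp1, hmean]
      ring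
  have hR := ae_tendsto_sum_div_logSize ρ hY
    (fun i j => Real.log (p i j) + ∑ j', Real.negMulLog (p i j')) hB₂ fun i => by
      rw [hρ, integral_finMeasure (hp0 i)]
      simp only [mul_add, Finset.sum_add_distrib, ← Finset.sum_mul, hp1, one_mul]
      rw [← Finset.sum_add_distrib]
      exact Finset.sum_eq_zero fun j _ => by rw [Real.negMulLog]; ring
  have hG : ∀ᵐ x ∂ν, x ∈ expLevel P α := by
    filter_upwards [hS] with x hx
    have h := tendsto_const_nhds (x := α) |>.sub hx
    rw [sub_zero] at h
    refine h.congr' ?_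
    filter_upwards [eventually_gt_atTop 0] with n hn
    have hpos := logSize_pos hY hn
    rw [Finset.sum_add_distrib, ← Finset.mul_sum, ← logSize, logMass]
    field_simp
    ring
  have hbound : ∀ t < s, ENNReal.ofReal t ≤ dimH (expLevel P α) := by
    intro t hts
    refine ofReal_le_dimH_of_measure_prefixSet_le hY hd ν hG t ?_
    filter_upwards [hR] with x hx
    have h1 := hx.eventually_lt_const (sub_pos.2 hts)
    filter_upwards [h1, eventually_gt_atTop 0] with n hn hn0
    have hpos := logSize_pos hY hn0
    rw [div_lt_iff₀ hpos, Finset.sum_add_distrib] at hn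
    have hsH : s * logSize Y n ≤ ∑ i ∈ Finset.range n, ∑ j', Real.negMulLog (p i j') := by
      rw [logSize, Finset.mul_sum]
      exact Finset.sum_le_sum fun i _ => hent i
    rw [hν, infinitePi_prefixSet]
    calc ∏ i ∈ Finset.range n, ρ i {x i}
        ≤ ∏ i ∈ Finset.range n, ENNReal.ofReal (Real.exp (Real.log (p i (x i)))) := by
          refine Finset.prod_le_prod' fun i _ => ?_
          rw [hρ, finMeasure_singleton]
          exact ENNReal.ofReal_le_ofReal (Real.le_exp_log _)
      _ = ENNReal.ofReal (Real.exp (∑ i ∈ Finset.range n, Real.log (p i (x i)))) := by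
          rw [Real.exp_sum, ENNReal.ofReal_prod_of_nonneg fun i _ => (Real.exp_pos _).le]
      _ ≤ ENNReal.ofReal (Real.exp (-(t * logSize Y n))) := by
          refine ENNReal.ofReal_le_ofReal (Real.exp_le_exp.2 ?_)
          linarith
  have hlim : Tendsto ENNReal.ofReal (𝓝[<] s) (𝓝 (ENNReal.ofReal s)) :=
    (ENNReal.continuous_ofReal.tendsto s).mono_left nhdsWithin_le_nhds
  exact le_of_tendsto hlim (eventually_nhdsWithin_of_forall hbound)

/-! ### Entropy of weights with prescribed mean -/

lemma exists_weights_approx {ι : Type} [Fintype ι] [Nonempty ι] (u : ι → ℝ) {A m : ℝ}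
    (hm : ∀ q, m ≤ A * q + Real.log (∑ i, Real.exp (q * u i))) {ε : ℝ} (hε : 0 < ε) :
    ∃ w ∈ stdSimplex ℝ ι, m ≤ ∑ i, Real.negMulLog (w i) ∧ |∑ i, w i * u i + A| ≤ ε := by
  set Z : ℝ → ℝ := fun q => ∑ i, Real.exp (q * u i) with hZ
  have hZpos : ∀ q, 0 < Z q := fun q => Finset.sum_pos (fun i _ => Real.exp_pos _)
    Finset.univ_nonempty
  have hZder : ∀ q, HasDerivAt Z (∑ i, Real.exp (q * u i) * u i) q := by
    intro q
    have := HasDerivAt.fun_sum (u := Finset.univ) (x := q)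
      (A := fun i q => Real.exp (q * u i)) (A' := fun i => Real.exp (q * u i) * u i)
      fun i _ => by simpa using ((hasDerivAt_id q).mul_const (u i)).exp
    exact this
  set F : ℝ → ℝ := fun q => A * q + Real.log (Z q) with hF
  set D : ℝ := F 0 - m + 1 with hD
  have hD0 : 0 < D := by
    have := hm 0
    simp only [hD, hF, hZ]
    linarith
  set δ : ℝ := ε ^ 2 / (4 * D) with hδ
  have hδ0 : 0 < δ := by positivity
  set Φ : ℝ → ℝ := fun q => F q + δ * q ^ 2 with hΦ
  have hder : ∀ q, HasDerivAt Φ (A + (∑ i, Real.exp (q * u i) * u i) / Z q + δ * (2 * q)) q := by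
    intro q
    have h1 := ((hasDerivAt_id q).const_mul A).add ((hZder q).log (hZpos q).ne')
    have h2 := h1.add (((hasDerivAt_id q).pow 2).const_mul δ)
    refine h2.congr_deriv ?_
    simp
  have hcont : Continuous Φ := continuous_iff_continuousAt.2 fun q => (hder q).continuousAt
  have htend : Tendsto Φ (cocompact ℝ) atTop := by
    have h1 : Tendsto (fun q : ℝ => m + δ * |q| ^ 2) (cocompact ℝ) atTop := by
      refine tendsto_atTop_add_const_left _ _ (Tendsto.const_mul_atTop hδ0 ?_)
      exact (tendsto_pow_atTop two_ne_zero).comp (tendsto_norm_cocompact_atTop (E := ℝ))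
    refine tendsto_atTop_mono (fun q => ?_) h1
    rw [sq_abs]
    have := hm q
    simp only [hΦ, hF, hZ]
    linarith
  obtain ⟨q, hq⟩ := hcont.exists_forall_le htend
  have hcrit : A + (∑ i, Real.exp (q * u i) * u i) / Z q + δ * (2 * q) = 0 :=
    IsLocalMin.hasDerivAt_eq_zero (Eventually.of_forall hq) (hder q)
  set w : ι → ℝ := fun i => Real.exp (q * u i) / Z q with hw
  have hw0 : ∀ i, 0 < w i := fun i => div_pos (Real.exp_pos _) (hZpos q)
  have hw1 : ∑ i, w i = 1 := by
    rw [← Finset.sum_div]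
    exact div_self (hZpos q).ne'
  have hmean : ∑ i, w i * u i = -A - 2 * δ * q := by
    have : ∑ i, w i * u i = (∑ i, Real.exp (q * u i) * u i) / Z q := by
      rw [Finset.sum_div]
      exact Finset.sum_congr rfl fun i _ => by rw [hw]; ring
    rw [this]
    linarith
  have hent : ∑ i, Real.negMulLog (w i) = F q + 2 * δ * q ^ 2 := by
    have h1 : ∀ i, Real.negMulLog (w i) = w i * Real.log (Z q) - q * (w i * u i) := by
      intro i
      rw [Real.negMulLog, hw, Real.log_div (Real.exp_pos _).ne' (hZpos q).ne', Real.log_exp]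
      ring
    rw [Finset.sum_congr rfl fun i _ => h1 i, Finset.sum_sub_distrib, ← Finset.sum_mul,
      ← Finset.mul_sum, hw1, hmean]
    simp only [hF]
    ring
  refine ⟨w, ⟨fun i => (hw0 i).le, hw1⟩, ?_, ?_⟩
  · rw [hent]
    have := hm q
    have h2 : 0 ≤ 2 * δ * q ^ 2 := by positivity
    simp only [hF, hZ]
    linarith
  · have h0 : δ * q ^ 2 ≤ D := by
      have h1 := hq 0
      have h2 := hm q
      simp only [hΦ, hF, hZ] at h1
      simp only [hD, hF, hZ]
      linarith
    rw [hmean]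
    refine abs_le_of_sq_le_sq ?_ hε.le
    have h1 : 4 * δ * D = ε ^ 2 := by
      rw [hδ]
      field_simp
    calc (-A - 2 * δ * q + A) ^ 2 = 4 * δ * (δ * q ^ 2) := by ring
      _ ≤ 4 * δ * D := mul_le_mul_of_nonneg_left h0 (by positivity)
      _ = ε ^ 2 := h1

/-- One half of the Gibbs variational principle: the entropy of weights with mean `-A`
attains every lower bound of `q ↦ A q + log ∑ exp (q uᵢ)`. -/
lemma exists_weights {ι : Type} [Fintype ι] [Nonempty ι] (u : ι → ℝ) {A m : ℝ}
    (hm : ∀ q, m ≤ A * q + Real.log (∑ i, Real.exp (q * u i))) :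
    ∃ w ∈ stdSimplex ℝ ι, m ≤ ∑ i, Real.negMulLog (w i) ∧ ∑ i, w i * u i = -A := by
  set K : Set (ι → ℝ) := stdSimplex ℝ ι ∩ {w | m ≤ ∑ i, Real.negMulLog (w i)} with hK
  have hKc : IsCompact K := (isCompact_stdSimplex ℝ ι).inter_right <|
    isClosed_le continuous_const <| continuous_finsetSum _ fun i _ =>
      Real.continuous_negMulLog.comp (continuous_apply i)
  obtain ⟨w₀, h1, h2, -⟩ := exists_weights_approx u hm one_pos
  have hcont : Continuous fun w : ι → ℝ => |∑ i, w i * u i + A| := by fun_prop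
  obtain ⟨w, hwK, hw⟩ := hKc.exists_isMinOn ⟨w₀, h1, h2⟩ hcont.continuousOn
  refine ⟨w, hwK.1, hwK.2, ?_⟩
  have : |∑ i, w i * u i + A| ≤ 0 := by
    refine le_of_forall_pos_le_add fun ε hε => ?_
    obtain ⟨v, hv1, hv2, hv3⟩ := exists_weights_approx u hm hε
    have : |∑ i, w i * u i + A| ≤ |∑ i, v i * u i + A| := hw ⟨hv1, hv2⟩
    linarith
  have := abs_nonpos_iff.1 this
  linarith

lemma exists_weights_of_bddBelow {c : ℕ} (hc : 2 ≤ c) {p : ℕ → ℝ} (hp : ∀ i, i < c → 0 < p i)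
    {α : ℝ} (hbdd : BddBelow (range fun y => α * y + theta c p y)) :
    ∃ w : ℕ → ℝ, (∀ i, 0 ≤ w i) ∧ ∑ i ∈ Finset.range c, w i = 1 ∧
      ∑ i ∈ Finset.range c, w i * Real.log (p i) = -(α * Real.log c) ∧
      leg (theta c p) α * Real.log c ≤ ∑ i ∈ Finset.range c, Real.negMulLog (w i) := by
  have : Nonempty (Fin c) := ⟨⟨0, by omega⟩⟩
  have hlog : 0 < Real.log c := Real.log_pos (by exact_mod_cast hc)
  obtain ⟨w, hw, hent, hmean⟩ := exists_weights (fun i : Fin c => Real.log (p i))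
    (A := α * Real.log c) (m := leg (theta c p) α * Real.log c) fun q => by
      have h1 : leg (theta c p) α ≤ α * q + theta c p q := ciInf_le hbdd q
      have h2 : ∑ i : Fin c, Real.exp (q * Real.log (p i)) =
          ∑ i ∈ Finset.range c, p i ^ q := by
        rw [← Fin.sum_univ_eq_sum_range (fun i => p i ^ q)]
        refine Finset.sum_congr rfl fun i _ => ?_
        rw [Real.rpow_def_of_pos (hp i i.2), mul_comm]
      rw [h2]
      calc leg (theta c p) α * Real.log c ≤ (α * q + theta c p q) * Real.log c :=
            mul_le_mul_of_nonneg_right h1 hlog.le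
        _ = _ := by
            rw [theta, Real.logb]
            field_simp
  refine ⟨fun i => if h : i < c then w ⟨i, h⟩ else 0, fun i => ?_, ?_, ?_, ?_⟩
  · dsimp only
    split_ifs
    · exact hw.1 _
    · exact le_rfl
  · rw [← Fin.sum_univ_eq_sum_range]
    simpa using hw.2
  · rw [← Fin.sum_univ_eq_sum_range
      fun i => (if h : i < c then w ⟨i, h⟩ else 0) * Real.log (p i)]
    simpa using hmean
  · rw [← Fin.sum_univ_eq_sum_range
      fun i => Real.negMulLog (if h : i < c then w ⟨i, h⟩ else 0)]
    simpa using hent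

/-! ### The mixed symbolic space -/

section Mixed

variable {c₁ c₂ : ℕ} {T : ℕ → ℕ}

lemma Ncount_succ (T : ℕ → ℕ) (n : ℕ) :
    Ncount T (n + 1) = Ncount T n + if isA T (n + 1) then 1 else 0 := by
  rw [Ncount, Ncount, ← Finset.insert_Icc_right_eq_Icc_add_one (by omega), Finset.filter_insert]
  split_ifs
  · rw [Finset.card_insert_of_notMem (by simp)]
  · rfl

lemma Ncount_le (T : ℕ → ℕ) (n : ℕ) : Ncount T n ≤ n :=
  (Finset.card_filter_le _ _).trans (by simp)

lemma sum_range_ite_isA (T : ℕ → ℕ) (A B : ℝ) (n : ℕ) :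
    ∑ i ∈ Finset.range n, (if isA T (i + 1) then A else B) =
      Ncount T n * A + (n - Ncount T n) * B := by
  induction n with
  | zero => simp [Ncount]
  | succ n ih =>
    rw [Finset.sum_range_succ, ih, Ncount_succ]
    split_ifs <;> push_cast <;> ring

lemma logSize_Yc (n : ℕ) : logSize (Yc c₁ c₂ T) n =
    Ncount T n * Real.log c₁ + (n - Ncount T n) * Real.log c₂ := by
  rw [← sum_range_ite_isA, logSize]
  refine Finset.sum_congr rfl fun i _ => ?_
  rw [Yc]
  split_ifs <;> rfl

lemma Dw_eq_exp_neg_logSize (hc₁ : 2 ≤ c₁) (hc₂ : 2 ≤ c₂) (n : ℕ) :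
    Dw c₁ c₂ T n = Real.exp (-logSize (Yc c₁ c₂ T) n) := by
  have h1 : (0 : ℝ) < c₁ := by exact_mod_cast (by omega : 0 < c₁)
  have h2 : (0 : ℝ) < c₂ := by exact_mod_cast (by omega : 0 < c₂)
  rw [Dw, Real.exp_neg, logSize_Yc, ← Nat.cast_sub (Ncount_le T n), Real.exp_add,
    Real.exp_nat_mul, Real.exp_nat_mul, Real.exp_log h1, Real.exp_log h2]

/-- The weight which is `f` at positions of the first alphabet and `g` at the others. -/
def mixWeight (c₁ c₂ : ℕ) (T : ℕ → ℕ) (f g : ℕ → ℝ) (i : ℕ) (j : Fin (Yc c₁ c₂ T i)) : ℝ :=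
  if isA T (i + 1) then f j else g j

lemma sum_mixWeight (f g : ℕ → ℝ) (i : ℕ) :
    ∑ j, mixWeight c₁ c₂ T f g i j =
      if isA T (i + 1) then ∑ j ∈ Finset.range c₁, f j else ∑ j ∈ Finset.range c₂, g j := by
  rw [show (∑ j, mixWeight c₁ c₂ T f g i j) = ∑ j ∈ Finset.range (Yc c₁ c₂ T i),
    (if isA T (i + 1) then f j else g j) from
      Fin.sum_univ_eq_sum_range (fun j => if isA T (i + 1) then f j else g j) _, Yc]
  split_ifs <;> rfl

lemma comp_mixWeight (F : ℝ → ℝ) (f g : ℕ → ℝ) (i : ℕ) (j : Fin (Yc c₁ c₂ T i)) :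
    F (mixWeight c₁ c₂ T f g i j) =
      mixWeight c₁ c₂ T (fun k => F (f k)) (fun k => F (g k)) i j := by
  rw [mixWeight, mixWeight]
  split_ifs <;> rfl

lemma mixWeight_mul (f g f' g' : ℕ → ℝ) (i : ℕ) (j : Fin (Yc c₁ c₂ T i)) :
    mixWeight c₁ c₂ T f g i j * mixWeight c₁ c₂ T f' g' i j =
      mixWeight c₁ c₂ T (fun k => f k * f' k) (fun k => g k * g' k) i j := by
  simp only [mixWeight]
  split_ifs <;> rfl

lemma mixWeight_forall {Q : ℝ → Prop} {f g : ℕ → ℝ} (hf : ∀ j, j < c₁ → Q (f j))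
    (hg : ∀ j, j < c₂ → Q (g j)) (i : ℕ) (j : Fin (Yc c₁ c₂ T i)) :
    Q (mixWeight c₁ c₂ T f g i j) := by
  have hj := j.2
  rw [mixWeight]
  split_ifs with h
  · exact hf _ (hj.trans_eq (if_pos h))
  · exact hg _ (hj.trans_eq (if_neg h))

lemma exists_abs_mixWeight_le (f g : ℕ → ℝ) : ∃ B, ∀ i j, |mixWeight c₁ c₂ T f g i j| ≤ B := by
  have key : ∀ (h : ℕ → ℝ) c j, j < c → |h j| ≤ ∑ k ∈ Finset.range c, |h k| := fun h c j hj =>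
    Finset.single_le_sum (f := fun k => |h k|) (fun k _ => abs_nonneg _) (Finset.mem_range.2 hj)
  refine ⟨max (∑ k ∈ Finset.range c₁, |f k|) (∑ k ∈ Finset.range c₂, |g k|),
    mixWeight_forall (Q := fun y => |y| ≤ _) (fun j hj => ?_) fun j hj => ?_⟩
  · exact (key f _ j hj).trans (le_max_left _ _)
  · exact (key g _ j hj).trans (le_max_right _ _)

lemma prefixSet_eq_cyl (x : Omg c₁ c₂ T) (n : ℕ) :
    prefixSet x n = cyl c₁ c₂ T n fun i => x i := by
  ext y
  exact ⟨fun h i => h i i.2, fun h i hi => h ⟨i, hi⟩⟩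

lemma cylWeight_eq_exp_neg_logMass {a b : ℕ → ℝ} (ha : ∀ i, i < c₁ → 0 < a i)
    (hb : ∀ j, j < c₂ → 0 < b j) (x : Omg c₁ c₂ T) (n : ℕ) :
    cylWeight c₁ c₂ T a b n (fun i => x i) =
      Real.exp (-logMass (mixWeight c₁ c₂ T a b) n x) := by
  rw [logMass, neg_neg, Real.exp_sum,
    Finset.prod_range fun i => Real.exp (Real.log (mixWeight c₁ c₂ T a b i (x i))), cylWeight]
  refine Finset.prod_congr rfl fun i _ => ?_
  rw [Real.exp_log (mixWeight_forall ha hb _ _), mixWeight]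

/-- Covering bound along generations with a prescribed limiting frequency of the first alphabet. -/
lemma dimH_expLevel_mixWeight_le [MetricSpace (Omg c₁ c₂ T)] (hc₁ : 2 ≤ c₁) (hc₂ : 2 ≤ c₂)
    (hd : ∀ (x y : Omg c₁ c₂ T) (n : ℕ), (∀ i, i < n → x i = y i) → x n ≠ y n →
      dist x y = Real.exp (-logSize (Yc c₁ c₂ T) n)) {a b : ℕ → ℝ}
    (ha : ∀ i, i < c₁ → 0 < a i) (hb : ∀ j, j < c₂ → 0 < b j) (α q ξ : ℝ)
    {φ : ℕ → ℕ} (hφ : Tendsto φ atTop atTop)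
    (hξ : Tendsto (fun k => (Ncount T (φ k) : ℝ) / φ k) atTop (𝓝 ξ))
    (hξ0 : 0 < ξ * Real.log c₁ + (1 - ξ) * Real.log c₂) :
    dimH (expLevel (mixWeight c₁ c₂ T a b) α) ≤ ENNReal.ofReal (α * q +
      (ξ * Real.log (∑ i ∈ Finset.range c₁, a i ^ q) +
        (1 - ξ) * Real.log (∑ i ∈ Finset.range c₂, b i ^ q)) /
      (ξ * Real.log c₁ + (1 - ξ) * Real.log c₂)) := by
  have hY : ∀ i, 2 ≤ Yc c₁ c₂ T i := fun i => by
    rw [Yc]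
    split_ifs <;> assumption
  refine dimH_expLevel_le hY hd _ (mixWeight_forall ha hb) α q _ hφ ?_
  have hlim : ∀ A B : ℝ, Tendsto (fun k => (Ncount T (φ k) : ℝ) / φ k * A +
      (1 - (Ncount T (φ k) : ℝ) / φ k) * B) atTop (𝓝 (ξ * A + (1 - ξ) * B)) := fun A B =>
    (hξ.mul_const A).add ((hξ.const_sub 1).mul_const B)
  refine ((hlim (Real.log (∑ i ∈ Finset.range c₁, a i ^ q))
    (Real.log (∑ i ∈ Finset.range c₂, b i ^ q))).div (hlim (Real.log c₁) (Real.log c₂))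
    hξ0.ne').congr' ?_
  filter_upwards [hφ.eventually_gt_atTop 0] with k hk
  have hk' : (φ k : ℝ) ≠ 0 := by exact_mod_cast hk.ne'
  have hterm : ∀ i, Real.log (∑ j, mixWeight c₁ c₂ T a b i j ^ q) =
      if isA T (i + 1) then Real.log (∑ i ∈ Finset.range c₁, a i ^ q)
      else Real.log (∑ i ∈ Finset.range c₂, b i ^ q) := by
    intro i
    rw [Finset.sum_congr rfl fun j _ => comp_mixWeight (fun y => y ^ q) a b i j, sum_mixWeight]
    split_ifs <;> rfl
  have hscale : ∀ A B : ℝ, (Ncount T (φ k) : ℝ) / φ k * A +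
      (1 - (Ncount T (φ k) : ℝ) / φ k) * B =
      (Ncount T (φ k) * A + (φ k - Ncount T (φ k)) * B) / φ k := fun A B => by
    field_simp
  simp only [Pi.div_apply]
  rw [Finset.sum_congr rfl fun i _ => hterm i, sum_range_ite_isA, logSize_Yc, hscale, hscale,
    div_div_div_cancel_right₀ hk']

lemma sub_Ncount_le (k : ℕ) :
    T (2 * k + 2) - 1 - Ncount T (T (2 * k + 2) - 1) ≤ T (2 * k + 1) := by
  set n := T (2 * k + 2) - 1 with hn
  have h1 : ((Finset.Icc 1 n).filter fun j => ¬isA T j).card ≤ T (2 * k + 1) := by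
    refine (Finset.card_le_card (t := Finset.range (T (2 * k + 1))) fun j hj => ?_).trans
      (Finset.card_range _).le
    rw [Finset.mem_filter, Finset.mem_Icc] at hj
    rw [Finset.mem_range]
    by_contra! h
    exact hj.2 ⟨k + 1, by omega, h, by rw [show 2 * (k + 1) = 2 * k + 2 by ring]; omega⟩
  have h2 := Finset.card_filter_add_card_filter_not (s := Finset.Icc 1 n) (isA T)
  rw [Nat.card_Icc] at h2
  rw [Ncount]
  omega

lemma tendsto_two_mul_atTop : Tendsto (fun k : ℕ => 2 * k) atTop atTop :=
  tendsto_atTop_mono (fun k => by simp only [id]; omega) tendsto_id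

lemma tendsto_two_mul_add_one_atTop : Tendsto (fun k : ℕ => 2 * k + 1) atTop atTop :=
  tendsto_atTop_mono (fun k => by simp only [id]; omega) tendsto_id

lemma monotone_blocks (hTmono : ∀ k, 1 ≤ k → T k < T (k + 1))
    {m n : ℕ} (hm : 1 ≤ m) (hmn : m ≤ n) : T m ≤ T n := by
  induction n, hmn using Nat.le_induction with
  | base => exact le_rfl
  | succ n hn ih => exact ih.trans (hTmono n (hm.trans hn)).le

lemma le_blocks (hTmono : ∀ k, 1 ≤ k → T k < T (k + 1))
    {n : ℕ} : n ≤ T (n + 1) := by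
  induction n with
  | zero => exact Nat.zero_le _
  | succ n ih => exact Nat.succ_le_of_lt (ih.trans_lt (hTmono (n + 1) (by omega)))

lemma tendsto_block_end (hTmono : ∀ k, 1 ≤ k → T k < T (k + 1)) :
    Tendsto (fun k => T (k + 2) - 1) atTop atTop := by
  refine tendsto_atTop_mono (fun k => ?_) tendsto_id
  have : k + 1 ≤ T (k + 2) := le_blocks hTmono
  simp only [id]
  omega

lemma tendsto_block_ratio (hTmono : ∀ k, 1 ≤ k → T k < T (k + 1))
    (hTrat : Tendsto (fun k => (T (k + 1) : ℝ) / (T k : ℝ)) atTop atTop) :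
    Tendsto (fun k => (T (k + 1) : ℝ) / ((T (k + 2) - 1 : ℕ) : ℝ)) atTop (𝓝 0) := by
  have h1 : Tendsto (fun k => 2 * (((T (k + 2) : ℝ) / (T (k + 1) : ℝ)))⁻¹) atTop (𝓝 0) := by
    have := (tendsto_inv_atTop_zero.comp (hTrat.comp (tendsto_add_atTop_nat 1))).const_mul 2
    simpa using this
  refine squeeze_zero' (Eventually.of_forall fun k => by positivity) ?_ h1
  filter_upwards [eventually_ge_atTop 1] with k hk
  have h2 : k + 1 ≤ T (k + 2) := le_blocks hTmono
  have h3 : (2 : ℝ) ≤ T (k + 2) := by exact_mod_cast (by omega : 2 ≤ T (k + 2))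
  rw [Nat.cast_sub (by omega), inv_div, Nat.cast_one, ← mul_div_assoc,
    div_le_div_iff₀ (by linarith) (by linarith)]
  have h4 : (0 : ℝ) ≤ T (k + 1) := Nat.cast_nonneg _
  nlinarith

lemma Ncount_block_end_le (hTmono : ∀ k, 1 ≤ k → T k < T (k + 1))
    (k : ℕ) : Ncount T (T (2 * k + 3) - 1) ≤ T (2 * k + 2) := by
  refine (Finset.card_le_card (t := Finset.range (T (2 * k + 2))) fun j hj => ?_).trans
    (Finset.card_range _).le
  rw [Finset.mem_filter, Finset.mem_Icc] at hj
  obtain ⟨⟨hj1, hj2⟩, k', hk1, hk2, hk3⟩ := hj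
  rw [Finset.mem_range]
  by_contra! h
  have h1 : k + 2 ≤ k' := by
    by_contra! hlt
    exact absurd (monotone_blocks hTmono (m := 2 * k') (n := 2 * k + 2) (by omega) (by omega))
      (by omega)
  have := monotone_blocks hTmono (m := 2 * k + 3) (n := 2 * k' - 1) (by omega) (by omega)
  omega

lemma tendsto_frequency_one (hTmono : ∀ k, 1 ≤ k → T k < T (k + 1))
    (hTrat : Tendsto (fun k => (T (k + 1) : ℝ) / (T k : ℝ)) atTop atTop) :
    Tendsto (fun k => (Ncount T (T (2 * k + 2) - 1) : ℝ) / ((T (2 * k + 2) - 1 : ℕ) : ℝ))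
      atTop (𝓝 1) := by
  have h1 := ((tendsto_block_ratio hTmono hTrat).comp tendsto_two_mul_atTop).const_sub 1
  rw [sub_zero] at h1
  refine tendsto_of_tendsto_of_tendsto_of_le_of_le' h1 tendsto_const_nhds ?_ ?_
  · filter_upwards [((tendsto_block_end hTmono).comp tendsto_two_mul_atTop).eventually_gt_atTop 0]
      with k hk
    simp only [Function.comp_apply] at hk ⊢
    have hk' : (0 : ℝ) < ((T (2 * k + 2) - 1 : ℕ) : ℝ) := by exact_mod_cast hk
    rw [le_div_iff₀ hk', sub_mul, div_mul_cancel₀ _ hk'.ne', one_mul, sub_le_iff_le_add]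
    exact_mod_cast (by have := sub_Ncount_le (T := T) k; omega :
      T (2 * k + 2) - 1 ≤ Ncount T (T (2 * k + 2) - 1) + T (2 * k + 1))
  · exact Eventually.of_forall fun k =>
      div_le_one_of_le₀ (by exact_mod_cast Ncount_le T _) (Nat.cast_nonneg _)

lemma tendsto_frequency_zero (hTmono : ∀ k, 1 ≤ k → T k < T (k + 1))
    (hTrat : Tendsto (fun k => (T (k + 1) : ℝ) / (T k : ℝ)) atTop atTop) :
    Tendsto (fun k => (Ncount T (T (2 * k + 3) - 1) : ℝ) / ((T (2 * k + 3) - 1 : ℕ) : ℝ))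
      atTop (𝓝 0) := by
  refine squeeze_zero (fun k => by positivity) (fun k => ?_)
    ((tendsto_block_ratio hTmono hTrat).comp tendsto_two_mul_add_one_atTop)
  exact div_le_div_of_nonneg_right (by exact_mod_cast Ncount_block_end_le hTmono k)
    (Nat.cast_nonneg _)

lemma le_ofReal_leg {f : ℝ → ℝ} {x : ℝ} {d : ℝ≥0∞}
    (h : ∀ y, d ≤ ENNReal.ofReal (x * y + f y)) : d ≤ ENNReal.ofReal (leg f x) := by
  by_cases hb : BddBelow (range fun y => x * y + f y)
  · by_contra! hlt
    have hd : d ≠ ⊤ := ne_top_of_le_ne_top ENNReal.ofReal_ne_top (h 0)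
    have hle : d.toReal ≤ leg f x := le_ciInf fun y => by
      have h1 := h y
      have h2 : 0 < d := lt_of_le_of_lt zero_le hlt
      rcases le_or_gt (x * y + f y) 0 with h0 | h0
      · rw [ENNReal.ofReal_of_nonpos h0] at h1
        exact absurd h2 (not_lt.2 h1)
      · exact ENNReal.toReal_le_of_le_ofReal h0.le h1
    exact absurd hlt (not_lt.2 (ENNReal.le_ofReal_iff_toReal_le hd
      (ENNReal.toReal_nonneg.trans hle) |>.2 hle))
  · obtain ⟨_, ⟨y, rfl⟩, hy⟩ := not_bddBelow_iff.1 hb 0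
    refine (h y).trans ?_
    rw [ENNReal.ofReal_of_nonpos hy.le]
    exact zero_le

end Mixed

/-- `dim X_μ(α) = min(θ_a^*(α), θ_b^*(α))` on the symbolic space. -/
theorem stmt14 (c₁ c₂ : ℕ) (hc₁ : 2 ≤ c₁) (hc₂ : 2 ≤ c₂)
    (T : ℕ → ℕ) (hT1 : T 1 = 1) (hTmono : ∀ k, 1 ≤ k → T k < T (k + 1))
    (hTrat : Tendsto (fun k => (T (k + 1) : ℝ) / (T k : ℝ)) atTop atTop)
    (a b : ℕ → ℝ) (ha : ∀ i, i < c₁ → 0 < a i ∧ a i < 1)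
    (hb : ∀ j, j < c₂ → 0 < b j ∧ b j < 1)
    (hsa : ∑ i ∈ Finset.range c₁, a i = 1) (hsb : ∑ j ∈ Finset.range c₂, b j = 1)
    [MetricSpace (Omg c₁ c₂ T)]
    (hdist : ∀ (x y : Omg c₁ c₂ T) (n : ℕ), (∀ i, i < n → x i = y i) → x n ≠ y n →
      dist x y = Dw c₁ c₂ T n)
    [BorelSpace (Omg c₁ c₂ T)]
    (μ : Measure (Omg c₁ c₂ T)) [IsProbabilityMeasure μ]
    (hμ : ∀ (n : ℕ) (w : Word c₁ c₂ T n),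
      μ (cyl c₁ c₂ T n w) = ENNReal.ofReal (cylWeight c₁ c₂ T a b n w))
    (α : ℝ) (hα1 : -Real.log (sOne c₁ c₂ a b) < α) (hα2 : α < -Real.log (sTwo c₁ c₂ a b)) :
    dimH (Xlev μ α) =
      ENNReal.ofReal (min (leg (theta c₁ a) α) (leg (theta c₂ b) α)) := by
  have ha0 : ∀ i, i < c₁ → 0 < a i := fun i hi => (ha i hi).1
  have hb0 : ∀ j, j < c₂ → 0 < b j := fun j hj => (hb j hj).1
  have hlog₁ : 0 < Real.log c₁ := Real.log_pos (by exact_mod_cast hc₁)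
  have hlog₂ : 0 < Real.log c₂ := Real.log_pos (by exact_mod_cast hc₂)
  have hY : ∀ i, 2 ≤ Yc c₁ c₂ T i := fun i => by
    rw [Yc]
    split_ifs <;> assumption
  have hlogY : ∀ i, Real.log (Yc c₁ c₂ T i) =
      if isA T (i + 1) then Real.log c₁ else Real.log c₂ := fun i => by
    rw [Yc]
    split_ifs <;> rfl
  have hd : ∀ (x y : Omg c₁ c₂ T) (n : ℕ), (∀ i, i < n → x i = y i) → x n ≠ y n →
      dist x y = Real.exp (-logSize (Yc c₁ c₂ T) n) := fun x y n h1 h2 => by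
    rw [hdist x y n h1 h2, Dw_eq_exp_neg_logSize hc₁ hc₂]
  have hμ' : ∀ x n, μ (prefixSet x n) =
      ENNReal.ofReal (Real.exp (-logMass (mixWeight c₁ c₂ T a b) n x)) := fun x n => by
    rw [prefixSet_eq_cyl, hμ, cylWeight_eq_exp_neg_logMass ha0 hb0]
  have hC : ∀ i, Real.log (Yc c₁ c₂ T i) ≤ max (Real.log c₁) (Real.log c₂) := fun i => by
    rw [hlogY]
    split_ifs
    · exact le_max_left _ _
    · exact le_max_right _ _
  rw [Xlev_eq_expLevel hY hd hC _ μ hμ' α]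
  refine le_antisymm ?_ ?_
  · have hA : dimH (expLevel (mixWeight c₁ c₂ T a b) α) ≤ ENNReal.ofReal (leg (theta c₁ a) α) := by
      refine le_ofReal_leg fun q => ?_
      have := dimH_expLevel_mixWeight_le hc₁ hc₂ hd ha0 hb0 α q 1 (φ := fun k => T (2 * k + 2) - 1)
        ((tendsto_block_end hTmono).comp tendsto_two_mul_atTop) (tendsto_frequency_one hTmono hTrat)
        (by simpa using hlog₁)
      simpa [theta, Real.logb] using this
    have hB : dimH (expLevel (mixWeight c₁ c₂ T a b) α) ≤ ENNReal.ofReal (leg (theta c₂ b) α) := by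
      refine le_ofReal_leg fun q => ?_
      have := dimH_expLevel_mixWeight_le hc₁ hc₂ hd ha0 hb0 α q 0 (φ := fun k => T (2 * k + 3) - 1)
        ((tendsto_block_end hTmono).comp tendsto_two_mul_add_one_atTop)
        (tendsto_frequency_zero hTmono hTrat) (by simpa using hlog₂)
      simpa [theta, Real.logb] using this
    rw [ENNReal.ofReal_min]
    exact le_min hA hB
  · by_cases hbd₁ : BddBelow (range fun y => α * y + theta c₁ a y)
    swap
    · have : leg (theta c₁ a) α = 0 := Real.sInf_of_not_bddBelow hbd₁
      simp [ENNReal.ofReal_of_nonpos, this]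
    by_cases hbd₂ : BddBelow (range fun y => α * y + theta c₂ b y)
    swap
    · have : leg (theta c₂ b) α = 0 := Real.sInf_of_not_bddBelow hbd₂
      simp [ENNReal.ofReal_of_nonpos, this]
    obtain ⟨w, hw0, hw1, hwm, hwe⟩ := exists_weights_of_bddBelow hc₁ ha0 hbd₁
    obtain ⟨v, hv0, hv1, hvm, hve⟩ := exists_weights_of_bddBelow hc₂ hb0 hbd₂
    have hent : ∀ i, ∑ j, Real.negMulLog (mixWeight c₁ c₂ T w v i j) =
        if isA T (i + 1) then ∑ j ∈ Finset.range c₁, Real.negMulLog (w j)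
        else ∑ j ∈ Finset.range c₂, Real.negMulLog (v j) := fun i => by
      rw [Finset.sum_congr rfl fun j _ => comp_mixWeight Real.negMulLog w v i j, sum_mixWeight]
    obtain ⟨B₁, hB₁⟩ := exists_abs_mixWeight_le (c₁ := c₁) (c₂ := c₂) (T := T)
      (fun j => Real.log (a j) + α * Real.log c₁) (fun j => Real.log (b j) + α * Real.log c₂)
    obtain ⟨B₂, hB₂⟩ := exists_abs_mixWeight_le (c₁ := c₁) (c₂ := c₂) (T := T)
      (fun j => Real.log (w j) + ∑ k ∈ Finset.range c₁, Real.negMulLog (w k))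
      (fun j => Real.log (v j) + ∑ k ∈ Finset.range c₂, Real.negMulLog (v k))
    refine ofReal_le_dimH_expLevel hY hd _ (mixWeight c₁ c₂ T w v) (B := max B₁ B₂)
      (mixWeight_forall (Q := fun y => 0 ≤ y) (fun j _ => hw0 j) fun j _ => hv0 j)
      (fun i => ?_) (fun i => ?_) (fun i => ?_) (fun i j => ?_) (fun i j => ?_)
    · rw [sum_mixWeight, hw1, hv1, ite_self]
    · have hm : ∀ j, mixWeight c₁ c₂ T w v i j * Real.log (mixWeight c₁ c₂ T a b i j) =
          mixWeight c₁ c₂ T (fun k => w k * Real.log (a k)) (fun k => v k * Real.log (b k)) i j :=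
        fun j => by rw [comp_mixWeight Real.log, mixWeight_mul]
      rw [Finset.sum_congr rfl fun j _ => hm j, sum_mixWeight, hwm, hvm, hlogY]
      split_ifs <;> rfl
    · rw [hent, hlogY]
      split_ifs
      · exact (mul_le_mul_of_nonneg_right (min_le_left _ _) hlog₁.le).trans hwe
      · exact (mul_le_mul_of_nonneg_right (min_le_right _ _) hlog₂.le).trans hve
    · refine le_trans (le_of_eq ?_) ((hB₁ i j).trans (le_max_left _ _))
      rw [hlogY]
      simp only [mixWeight]
      split_ifs <;> rfl
    · refine le_trans (le_of_eq ?_) ((hB₂ i j).trans (le_max_right _ _))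
      rw [hent]
      simp only [mixWeight]
      split_ifs <;> rfl
end MF
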